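/- For γ ∈ P_{n,r} and δ ∈ P_{m,s}, the operations of the dendriform trialgebra k[P_∞] are given by weak-Bruhat-order intervals: (1) γ≻δ = Σ ω over all ω ∈ P_{n+m} with γ×δ ≤_B ω ≤_B (ξ_{r,s−1}×1₁)∘(γ×δ); (2) γ·δ = Σ ω over all ω with z(r−1,s−1,0)∘(γ×δ) ≤_B ω ≤_B (ξ_{r−1,s−1}×1₁)∘z(r−1,s−1,0)∘(γ×δ); (3) γ≺δ = Σ ω over all ω with z(r−1,s)∘(γ×δ) ≤_B ω ≤_B ξ_{r,s}∘(γ×δ); (4) γ*δ = Σ ω over all ω with γ×δ ≤_B ω ≤_B ξ_{r,s}∘(γ×δ); here z(r−1,s−1,0) := (1,…,r−1, r+s−1, r,…,r+s−1) ∈ P_{r+s,r+s−1} and z(r−1,s) := (1,…,r−1, r+s, r,…,r+s−1) ∈ P_{r+s,r+s}. -/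

import Mathlib

namespace PaperP

/-- `IsPF n r f` : `f` represents a surjective map `{1,…,n} → {1,…,r}` (an element of
`P_{n,r}`), normalized so that `f v = 0` for `v ∉ {1,…,n}`. -/
def IsPF (n r : ℕ) (f : ℕ → ℕ) : Prop :=
  (∀ v : ℕ, f v ≠ 0 ↔ (1 ≤ v ∧ v ≤ n)) ∧ f '' Set.Icc 1 n = Set.Icc 1 r

/-- The product `γ × δ ∈ P_{n+m,r+s}` of `γ ∈ P_{n,r}` and `δ ∈ P_{m,s}`:
`(γ×δ)(i) = γ(i)` for `1 ≤ i ≤ n` and `(γ×δ)(n+i) = δ(i)+r` for `1 ≤ i ≤ m`. -/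
def prodF (n r : ℕ) (f g : ℕ → ℕ) : ℕ → ℕ := fun v =>
  if v ≤ n then f v else if g (v - n) = 0 then 0 else g (v - n) + r

/-- The identity map `1_r` of `{1,…,r}`. -/
def idF (r : ℕ) : ℕ → ℕ := fun v => if 1 ≤ v ∧ v ≤ r then v else 0

/-- The map `t_i ∈ P_{r,r-1}` : `t_i(j) = j` for `j ≤ i` and `t_i(j) = j-1` for `j > i`. -/
def tF (r i : ℕ) : ℕ → ℕ := fun v =>
  if 1 ≤ v ∧ v ≤ r then (if v ≤ i then v else v - 1) else 0

/-- The block-increasing condition: `γ` is increasing on each of the consecutive blocks of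
sizes `ns = (n₁,…,n_r)` (positions are 1-based). -/
def BlockIncr (ns : List ℕ) (f : ℕ → ℕ) : Prop :=
  ∀ j < ns.length, ∀ a b : ℕ, (ns.take j).sum < a → a < b → b ≤ (ns.take (j + 1)).sum →
    f a < f b

/-- Membership in the set of shuffles `SH(n₁,…,n_r) ⊆ P_n`, `n = n₁+…+n_r`. -/
def InSH (ns : List ℕ) (f : ℕ → ℕ) : Prop :=
  (∃ r : ℕ, IsPF ns.sum r f) ∧ BlockIncr ns f

/-- `γ⁻¹(i) < γ⁻¹(i+1)` : every element of `γ⁻¹(i)` is smaller than every element of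
`γ⁻¹(i+1)`. -/
def InvIncr (f : ℕ → ℕ) (i : ℕ) : Prop := ∀ a b : ℕ, f a = i → f b = i + 1 → a < b

/-- `γ⁻¹(i) > γ⁻¹(i+1)` : every element of `γ⁻¹(i)` is larger than every element of
`γ⁻¹(i+1)`. -/
def InvDecr (f : ℕ → ℕ) (i : ℕ) : Prop := ∀ a b : ℕ, f a = i → f b = i + 1 → b < a

/-- One covering step of the weak Bruhat order on `P_n` :
`γ <_B t_i ∘ γ` when `γ⁻¹(i) < γ⁻¹(i+1)`, and `t_i ∘ γ <_B γ` when `γ⁻¹(i) > γ⁻¹(i+1)`,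
for `γ ∈ P_{n,r}` and `1 ≤ i ≤ r-1`. -/
def BStep (n : ℕ) (f g : ℕ → ℕ) : Prop :=
  ∃ r i : ℕ, 1 ≤ i ∧ i + 1 ≤ r ∧
    ((IsPF n r f ∧ InvIncr f i ∧ g = tF r i ∘ f) ∨
     (IsPF n r g ∧ InvDecr g i ∧ f = tF r i ∘ g))

/-- The weak Bruhat order `≤_B` on `P_n`, the reflexive-transitive closure of `BStep`. -/
def BLE (n : ℕ) : (ℕ → ℕ) → (ℕ → ℕ) → Prop := Relation.ReflTransGen (BStep n)

/-- Turn a (1-based) list of values into a normalized map `ℕ → ℕ`. -/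
def ofList (l : List ℕ) : ℕ → ℕ := fun v => if v = 0 then 0 else l.getD (v - 1) 0

/-- The maximal shuffle `ξ_{n₁,…,n_r}` :
`ξ(k) = k - (n₁+…+n_{j-1}) + (n_{j+1}+…+n_r)` for `n₁+…+n_{j-1} < k ≤ n₁+…+n_j`. -/
def xiF : List ℕ → ℕ → ℕ
  | [], _ => 0
  | m :: rest, k =>
      if k = 0 then 0 else if k ≤ m then k + rest.sum else xiF rest (k - m)

/-- The list `z(n₀,…,n_k) = (1,…,n₀, n+1, n₀+1,…,n₀+n₁, n+1, …, n+1, n₀+…+n_{k-1}+1,…,n)`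
where `n = n₀+…+n_k` (built with an accumulator `start`). -/
def zList (n : ℕ) : ℕ → List ℕ → List ℕ
  | _, [] => []
  | start, [m] => List.range' (start + 1) m
  | start, m :: rest => List.range' (start + 1) m ++ (n + 1) :: zList n (start + m) rest

/-- `z(n₀,…,n_k)` as a normalized map. -/
def zF (ns : List ℕ) : ℕ → ℕ := ofList (zList ns.sum 0 ns)

/-- The iterated product `γ₀ × … × γ_k` of a family, each member given as a triple
`(nᵢ, rᵢ, γᵢ)` with `γᵢ ∈ P_{nᵢ,rᵢ}`; returns `(Σnᵢ, Σrᵢ, γ₀×…×γ_k)`. -/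
def prodFam : List (ℕ × ℕ × (ℕ → ℕ)) → ℕ × ℕ × (ℕ → ℕ)
  | [] => (0, 0, fun _ => 0)
  | (n, r, f) :: rest =>
      let p := prodFam rest
      (n + p.1, r + p.2.1, prodF n r f p.2.2)

/-- The wedge `⋁_ω(γ₀,…,γ_k) = ((ω ∘ (γ₀×…×γ_k)) × 1₁) ∘ z(n₀,…,n_k)` of a family
`γᵢ ∈ P_{nᵢ,rᵢ}` over a shuffle `ω ∈ SH(r₀,…,r_k)`. -/
def wedgeF (ω : ℕ → ℕ) (fam : List (ℕ × ℕ × (ℕ → ℕ))) : ℕ → ℕ :=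
  prodF (prodFam fam).1 (prodFam fam).2.1 (ω ∘ (prodFam fam).2.2) (idF 1) ∘
    zF (fam.map (·.1))

/-- The free vector space over `k` spanned by `P_∞` (basis elements are encoded as pairs
`(n, γ)` with `γ ∈ P_{n,r}` for some `r`). -/
abbrev FreeP (k : Type*) [Field k] := (ℕ × (ℕ → ℕ)) →₀ k

/-- The rank `r` of an element `γ ∈ P_{n,r}` (its largest value). -/
noncomputable def rankF (f : ℕ → ℕ) : ℕ := sSup (Set.range f)

/-- Generic shuffle-sum operation on basis elements: given a condition `c` selecting a class of
`(r,s)`-shuffles, maps `γ ∈ P_{n,r}`, `δ ∈ P_{m,s}` to `Σ_{ω ∈ SH(r,s), c} ω ∘ (γ×δ)`. -/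
noncomputable def shOp (k : Type*) [Field k] (c : ℕ → ℕ → (ℕ → ℕ) → Prop) :
    ℕ × (ℕ → ℕ) → ℕ × (ℕ → ℕ) → FreeP k := fun a b =>
  ∑ᶠ ω ∈ {ω : ℕ → ℕ | InSH [rankF a.2, rankF b.2] ω ∧ c (rankF a.2) (rankF b.2) ω},
    Finsupp.single (a.1 + b.1, ω ∘ prodF a.1 (rankF a.2) a.2 b.2) (1 : k)

/-- Bilinear extension of an operation defined on basis elements. -/
noncomputable def lift2 {k : Type*} [Field k]
    (op : ℕ × (ℕ → ℕ) → ℕ × (ℕ → ℕ) → FreeP k) (x y : FreeP k) : FreeP k :=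
  x.sum fun a ca => y.sum fun b cb => (ca * cb) • op a b

/-- The operation `≻` on `k[P_∞]` : `γ ≻ δ = Σ_{ω ∈ SH^≻(r,s)} ω ∘ (γ×δ)`. -/
noncomputable def succP (k : Type*) [Field k] : FreeP k → FreeP k → FreeP k :=
  lift2 (shOp k fun r s ω => ω r < ω (r + s))

/-- The operation `·` on `k[P_∞]` : `γ · δ = Σ_{ω ∈ SH^•(r,s)} ω ∘ (γ×δ)`. -/
noncomputable def dotP (k : Type*) [Field k] : FreeP k → FreeP k → FreeP k :=
  lift2 (shOp k fun r s ω => ω r = ω (r + s))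

/-- The operation `≺` on `k[P_∞]` : `γ ≺ δ = Σ_{ω ∈ SH^≺(r,s)} ω ∘ (γ×δ)`. -/
noncomputable def precP (k : Type*) [Field k] : FreeP k → FreeP k → FreeP k :=
  lift2 (shOp k fun r s ω => ω (r + s) < ω r)

/-- The associative product `* = ≻ + · + ≺` on `k[P_∞]`. -/
noncomputable def starP (k : Type*) [Field k] (x y : FreeP k) : FreeP k :=
  succP k x y + dotP k x y + precP k x y

theorem isPF_iff {n r : ℕ} {f : ℕ → ℕ} : IsPF n r f ↔
    (∀ v, f v ≠ 0 ↔ (1 ≤ v ∧ v ≤ n)) ∧ (∀ v, f v ≤ r) ∧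
      ∀ k, 1 ≤ k → k ≤ r → ∃ v, f v = k := by
  constructor
  · rintro ⟨h0, h1⟩
    refine ⟨h0, fun v => ?_, fun k hk hk' => ?_⟩
    · by_cases hv : f v = 0
      · omega
      · have : f v ∈ f '' Set.Icc 1 n := ⟨v, (h0 v).1 hv, rfl⟩
        rw [h1] at this
        exact this.2
    · have : k ∈ f '' Set.Icc 1 n := h1 ▸ ⟨hk, hk'⟩
      obtain ⟨v, _, hv⟩ := this
      exact ⟨v, hv⟩
  · rintro ⟨h0, h1, h2⟩
    refine ⟨h0, Set.ext fun k => ⟨?_, ?_⟩⟩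
    · rintro ⟨v, hv, rfl⟩
      have := (h0 v).2 hv
      exact ⟨by omega, h1 v⟩
    · rintro ⟨hk, hk'⟩
      obtain ⟨v, hv⟩ := h2 k hk hk'
      exact ⟨v, (h0 v).1 (by omega), hv⟩

theorem inSH_pair_iff {r s : ℕ} {f : ℕ → ℕ} : InSH [r, s] f ↔
    (∃ u, IsPF (r + s) u f) ∧ (∀ a b, 0 < a → a < b → b ≤ r → f a < f b) ∧
      ∀ a b, r < a → a < b → b ≤ r + s → f a < f b := by
  unfold InSH BlockIncr
  refine and_congr (by simp) ⟨fun h => ⟨?_, ?_⟩, ?_⟩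
  · simpa using h 0 (by simp)
  · simpa using h 1 (by simp)
  · rintro ⟨h0, h1⟩ j hj
    have : j = 0 ∨ j = 1 := by simp at hj; omega
    rcases this with rfl | rfl
    · simpa using h0
    · simpa using h1

theorem rankF_eq {n r : ℕ} {f : ℕ → ℕ} (h : IsPF n r f) : rankF f = r := by
  obtain ⟨h0, h1, h2⟩ := isPF_iff.1 h
  refine IsGreatest.csSup_eq ⟨?_, ?_⟩
  · rcases Nat.eq_zero_or_pos r with rfl | hr
    · exact ⟨0, by have := h1 0; omega⟩
    · exact h2 r hr le_rfl
  · rintro _ ⟨v, rfl⟩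
    exact h1 v

theorem finite_setOf_isPF (n : ℕ) : {f : ℕ → ℕ | ∃ r, IsPF n r f}.Finite := by
  have hrank : ∀ {r f}, IsPF n r f → r ≤ n := by
    intro r f h
    have := Set.ncard_image_le (f := f) (Set.finite_Icc 1 n)
    rw [h.2, Set.ncard_eq_toFinset_card', Set.ncard_eq_toFinset_card'] at this
    simpa using this
  refine Set.Finite.of_finite_image (f := fun (f : ℕ → ℕ) (i : Fin (n + 1)) => f i)
    ((Set.Finite.pi' (fun _ : Fin (n + 1) => Set.finite_Iic n)).subset ?_) ?_
  · rintro _ ⟨f, ⟨r, hf⟩, rfl⟩ i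
    exact ((isPF_iff.1 hf).2.1 i).trans (hrank hf)
  · rintro f ⟨r, hf⟩ g ⟨q, hg⟩ h
    funext v
    by_cases hv : v ≤ n
    · exact congrFun h ⟨v, by omega⟩
    · have h1 := (hf.1 v).not.2 (by omega)
      have h2 := (hg.1 v).not.2 (by omega)
      omega

/-- The relative order of the values at `a` and `b` is at least as inverted in `g` as in `f`. -/
def PairLE (f g : ℕ → ℕ) (a b : ℕ) : Prop :=
  (f b < f a → g b < g a) ∧ (f b ≤ f a → g b ≤ g a)

theorem BLE.pairLE {n : ℕ} {f g : ℕ → ℕ} (h : BLE n f g) {a b : ℕ} (hab : a < b) :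
    PairLE f g a b := by
  induction h with
  | refl => exact ⟨id, id⟩
  | @tail f' g' _ hstep ih =>
    suffices h : PairLE f' g' a b from ⟨h.1 ∘ ih.1, h.2 ∘ ih.2⟩
    obtain ⟨r, i, hi, hir, ⟨hf, hinv, rfl⟩ | ⟨hg, hinv, rfl⟩⟩ := hstep
    · have h1 := (isPF_iff.1 hf).2.1
      have ha := h1 a
      have hb := h1 b
      have := hinv b a
      simp only [PairLE, tF, Function.comp]
      split_ifs <;> omega
    · have h1 := (isPF_iff.1 hg).2.1
      have ha := h1 a
      have hb := h1 b
      have := hinv a b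
      simp only [PairLE, tF, Function.comp]
      split_ifs <;> omega

theorem IsPF.le_of_lt_imp_lt {n r q : ℕ} {f g : ℕ → ℕ} (hf : IsPF n r f) (hg : IsPF n q g)
    (h : ∀ a b, 1 ≤ a → a ≤ n → 1 ≤ b → b ≤ n → f a < f b → g a < g b) (b : ℕ) :
    f b ≤ g b := by
  obtain ⟨hf0, hf1, hf2⟩ := isPF_iff.1 hf
  induction hk : f b using Nat.strong_induction_on generalizing b with
  | _ k ih =>
    subst hk
    have hfb := hf0 b
    have hgb := hg.1 b
    have hr := hf1 b
    by_cases h1 : f b ≤ 1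
    · omega
    obtain ⟨a, ha⟩ := hf2 (f b - 1) (by omega) (by omega)
    have hfa := hf0 a
    have := ih (f a) (by omega) a rfl
    have := h a b (by omega) (by omega) (by omega) (by omega) (by omega)
    omega

theorem IsPF.ext_of_lt_iff_lt {n r q : ℕ} {f g : ℕ → ℕ} (hf : IsPF n r f) (hg : IsPF n q g)
    (h : ∀ a b, 1 ≤ a → a ≤ n → 1 ≤ b → b ≤ n → (f a < f b ↔ g a < g b)) : f = g :=
  funext fun v => le_antisymm
    (hf.le_of_lt_imp_lt hg (fun a b h1 h2 h3 h4 => (h a b h1 h2 h3 h4).1) v)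
    (hg.le_of_lt_imp_lt hf (fun a b h1 h2 h3 h4 => (h a b h1 h2 h3 h4).2) v)

/-- `f` and `g` compare any two positions on the same side of `n` in the same way. -/
def SameSides (n m : ℕ) (f g : ℕ → ℕ) : Prop :=
  ∀ a b, 1 ≤ a → a ≤ n + m → 1 ≤ b → b ≤ n + m → (a ≤ n ↔ b ≤ n) → (f a < f b ↔ g a < g b)

/-- The number of weakly plus strictly increasing pairs across `n`. -/
def crossWeight (n m : ℕ) (f : ℕ → ℕ) : ℕ :=
  ∑ p ∈ Finset.Icc 1 n ×ˢ Finset.Ioc n (n + m),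
    ((if f p.1 < f p.2 then 1 else 0) + if f p.1 ≤ f p.2 then 1 else 0)

theorem crossWeight_lt {n m : ℕ} {f g : ℕ → ℕ}
    (h : ∀ a b, 1 ≤ a → a ≤ n → n < b → b ≤ n + m → PairLE f g a b)
    {a b : ℕ} (ha : 1 ≤ a) (han : a ≤ n) (hb : n < b) (hbm : b ≤ n + m)
    (hab : ¬ PairLE g f a b) : crossWeight n m g < crossWeight n m f := by
  refine Finset.sum_lt_sum ?_ ⟨(a, b), by simp; omega, ?_⟩
  · rintro ⟨c, d⟩ hcd
    simp only [Finset.mem_product, Finset.mem_Icc, Finset.mem_Ioc] at hcd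
    have := h c d (by omega) (by omega) (by omega) (by omega)
    simp only [PairLE] at this
    dsimp only
    split_ifs <;> omega
  · have := h a b ha han hb hbm
    simp only [PairLE] at this hab
    dsimp only
    split_ifs <;> omega

/-- Separate the level `x` of `f`, putting the positions beyond `n` first. -/
def splitAt (n x : ℕ) (f : ℕ → ℕ) : ℕ → ℕ := fun v =>
  if f v < x ∨ (f v = x ∧ n < v) then f v else f v + 1

theorem isPF_splitAt {n N x u : ℕ} {f : ℕ → ℕ} (hf : IsPF N u f) {a b : ℕ} (han : a ≤ n)
    (hb : n < b) (hx : 1 ≤ x) (hfa : f a = x) (hfb : f b = x) :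
    IsPF N (u + 1) (splitAt n x f) := by
  obtain ⟨h0, h1, h2⟩ := isPF_iff.1 hf
  refine isPF_iff.2 ⟨fun v => ?_, fun v => ?_, fun k hk hk' => ?_⟩
  · rw [← h0 v, splitAt]
    split_ifs <;> omega
  · have := h1 v
    rw [splitAt]
    split_ifs <;> omega
  · rcases lt_trichotomy k x with hlt | rfl | hgt
    · obtain ⟨v, hv⟩ := h2 k hk (by have := h1 a; omega)
      exact ⟨v, by rw [splitAt]; split_ifs <;> omega⟩
    · exact ⟨b, by rw [splitAt]; split_ifs <;> omega⟩
    · rcases Nat.eq_or_lt_of_le hgt with rfl | hgt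
      · exact ⟨a, by rw [splitAt]; split_ifs <;> omega⟩
      · obtain ⟨v, hv⟩ := h2 (k - 1) (by omega) (by omega)
        exact ⟨v, by rw [splitAt]; split_ifs <;> omega⟩

theorem bStep_splitAt {n N x u : ℕ} {f : ℕ → ℕ} (hf : IsPF N u f) {a b : ℕ} (han : a ≤ n)
    (hb : n < b) (hx : 1 ≤ x) (hfa : f a = x) (hfb : f b = x) :
    BStep N f (splitAt n x f) := by
  have h1 := (isPF_iff.1 hf).2.1
  have hxu := h1 a
  refine ⟨u + 1, x, hx, by omega, Or.inr ⟨isPF_splitAt hf han hb hx hfa hfb, ?_, ?_⟩⟩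
  · intro c d
    simp only [splitAt]
    split_ifs <;> omega
  · funext v
    have := h1 v
    simp only [Function.comp, splitAt, tF]
    split_ifs <;> omega

theorem isPF_tF_comp {N x u : ℕ} {f : ℕ → ℕ} (hf : IsPF N u f) (hx : 1 ≤ x) (hxu : x + 1 ≤ u) :
    IsPF N (u - 1) (tF u x ∘ f) := by
  obtain ⟨h0, h1, h2⟩ := isPF_iff.1 hf
  refine isPF_iff.2 ⟨fun v => ?_, fun v => ?_, fun k hk hk' => ?_⟩
  · have := h1 v
    rw [← h0 v]
    simp only [Function.comp, tF]
    split_ifs <;> omega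
  · have := h1 v
    simp only [Function.comp, tF]
    split_ifs <;> omega
  · rcases le_or_gt k x with hle | hgt
    · obtain ⟨v, hv⟩ := h2 k hk (by omega)
      exact ⟨v, by simp only [Function.comp, tF]; split_ifs <;> omega⟩
    · obtain ⟨v, hv⟩ := h2 (k + 1) (by omega) (by omega)
      exact ⟨v, by simp only [Function.comp, tF]; split_ifs <;> omega⟩

/-- Two packed words agreeing on each side of `n` and not yet equal: there is a step up from the
smaller one that stays below the larger one. -/
theorem exists_bStep {n m u : ℕ} {f g : ℕ → ℕ} (hf : IsPF (n + m) u f)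
    (hs : SameSides n m f g)
    {a b : ℕ} (ha : 1 ≤ a) (han : a ≤ n) (hb : n < b) (hbm : b ≤ n + m)
    (hle : ∀ a b, 1 ≤ a → a ≤ n → n < b → b ≤ n + m → PairLE f g a b)
    (hab : ¬ PairLE g f a b) :
    ∃ f' u', BStep (n + m) f f' ∧ IsPF (n + m) u' f' ∧ SameSides n m f' g ∧
      (∀ a b, 1 ≤ a → a ≤ n → n < b → b ≤ n + m → PairLE f' g a b) ∧
      crossWeight n m f' < crossWeight n m f := by
  classical
  obtain ⟨h0, h1, h2⟩ := isPF_iff.1 hf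
  have hex : ∃ d a b, 1 ≤ a ∧ a ≤ n ∧ n < b ∧ b ≤ n + m ∧ ¬ PairLE g f a b ∧ f b - f a = d :=
    ⟨_, a, b, ha, han, hb, hbm, hab, rfl⟩
  obtain ⟨a, b, ha, han, hb, hbm, hab, hd⟩ := Nat.find_spec hex
  have hmin : ∀ c d, 1 ≤ c → c ≤ n → n < d → d ≤ n + m → ¬ PairLE g f c d →
      f b - f a ≤ f d - f c := fun c d h1 h2 h3 h4 h5 =>
    hd ▸ Nat.find_min' hex ⟨c, d, h1, h2, h3, h4, h5, rfl⟩
  clear hd hex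
  have hfa := h0 a
  have hfb := h0 b
  simp only [PairLE] at hab hmin
  have hua := h1 a
  have hub := h1 b
  by_cases hxy : f a = f b
  · have hstep := bStep_splitAt hf han hb (by omega) rfl hxy.symm
    have hpf := isPF_splitAt hf han hb (by omega) rfl hxy.symm
    refine ⟨_, _, hstep, hpf, ?_, ?_, crossWeight_lt
      (fun c d _ hc hd _ => BLE.pairLE (.single hstep) (by omega))
      ha han hb hbm ?_⟩
    · intro c d hc hcn hd hdn hcd
      rw [← hs c d hc hcn hd hdn hcd]
      simp only [splitAt]
      split_ifs <;> omega
    · intro c d hc hcn hd hdn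
      have h1 := hle c d hc hcn hd hdn
      have h2 := hs c a hc (by omega) ha (by omega) (by omega)
      have h3 := hs a c ha (by omega) hc (by omega) (by omega)
      have h4 := hs d b (by omega) (by omega) (by omega) (by omega) (by omega)
      have h5 := hs b d (by omega) (by omega) (by omega) (by omega) (by omega)
      simp only [PairLE, splitAt] at h1 ⊢
      split_ifs <;> omega
    · simp only [PairLE, splitAt]
      split_ifs <;> omega
  · have hlt : f a < f b := by omega
    have hleft : ∀ c, 1 ≤ c → c ≤ n → f c ≤ f a ∨ f b < f c := by
      intro c hc hcn
      have h3 := hs a c ha (by omega) hc (by omega) (by omega)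
      have := hmin c b hc hcn hb hbm
      omega
    have hright : ∀ d, n < d → d ≤ n + m → f d < f a ∨ f b ≤ f d := by
      intro d hd hdn
      have h3 := hs d b (by omega) (by omega) (by omega) (by omega) (by omega)
      have := hmin a d ha han hd hdn
      omega
    have hsucc : f b = f a + 1 := by
      obtain ⟨v, hv⟩ := h2 (f a + 1) (by omega) (by omega)
      have hv0 := h0 v
      have := hleft v
      have := hright v
      omega
    have hstep : BStep (n + m) f (tF u (f a) ∘ f) := by
      refine ⟨u, f a, by omega, by omega, Or.inl ⟨hf, fun c d hc hd => ?_, rfl⟩⟩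
      have := h0 c
      have := h0 d
      have := hleft d
      have := hright c
      omega
    refine ⟨_, _, hstep, isPF_tF_comp hf (by omega) (by omega), ?_, ?_, crossWeight_lt
      (fun c d _ hc hd _ => BLE.pairLE (.single hstep) (by omega))
      ha han hb hbm ?_⟩
    · intro c d hc hcn hd hdn hcd
      rw [← hs c d hc hcn hd hdn hcd]
      have := h0 c
      have := h0 d
      have := h1 c
      have := h1 d
      have := hleft c
      have := hright c
      have := hleft d
      have := hright d
      simp only [Function.comp, tF]
      split_ifs <;> omega
    · intro c d hc hcn hd hdn
      have e1 := hle c d hc hcn hd hdn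
      have e2 := hs c a hc (by omega) ha (by omega) (by omega)
      have e3 := hs a c ha (by omega) hc (by omega) (by omega)
      have e4 := hs d b (by omega) (by omega) (by omega) (by omega) (by omega)
      have e5 := hs b d (by omega) (by omega) (by omega) (by omega) (by omega)
      have := h0 c
      have := h0 d
      have := h1 c
      have := h1 d
      have := hleft c
      have := hright d
      simp only [PairLE, Function.comp, tF] at e1 ⊢
      split_ifs <;> omega
    · simp only [PairLE, Function.comp, tF]
      split_ifs <;> omega

theorem ble_of_pairLE {n m u q : ℕ} {f g : ℕ → ℕ} (hf : IsPF (n + m) u f)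
    (hg : IsPF (n + m) q g) (hs : SameSides n m f g)
    (hle : ∀ a b, 1 ≤ a → a ≤ n → n < b → b ≤ n + m → PairLE f g a b) :
    BLE (n + m) f g := by
  induction hk : crossWeight n m f using Nat.strong_induction_on generalizing f u with
  | _ k ih =>
    by_cases hbad : ∃ a b, 1 ≤ a ∧ a ≤ n ∧ n < b ∧ b ≤ n + m ∧ ¬ PairLE g f a b
    · obtain ⟨a, b, ha, han, hb, hbm, hab⟩ := hbad
      obtain ⟨f', u', hstep, hf', hs', hle', hlt⟩ := exists_bStep hf hs ha han hb hbm hle hab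
      exact .head hstep (ih _ (hk ▸ hlt) hf' hs' hle' rfl)
    · push Not at hbad
      have : f = g := hf.ext_of_lt_iff_lt hg fun a b ha han hb hbn => by
        by_cases h1 : a ≤ n <;> by_cases h2 : b ≤ n
        · exact hs a b ha han hb hbn (by omega)
        · have e1 := hle a b ha h1 (by omega) hbn
          have e2 := hbad a b ha h1 (by omega) hbn
          simp only [PairLE] at e1 e2
          omega
        · have e1 := hle b a hb h2 (by omega) han
          have e2 := hbad b a hb h2 (by omega) han
          simp only [PairLE] at e1 e2
          omega
        · exact hs a b ha han hb hbn (by omega)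
      exact this ▸ .refl

theorem isPF_prodF {n r m s : ℕ} {γ δ : ℕ → ℕ} (hγ : IsPF n r γ) (hδ : IsPF m s δ) :
    IsPF (n + m) (r + s) (prodF n r γ δ) := by
  obtain ⟨h0, h1, h2⟩ := isPF_iff.1 hγ
  obtain ⟨k0, k1, k2⟩ := isPF_iff.1 hδ
  refine isPF_iff.2 ⟨fun v => ?_, fun v => ?_, fun k hk hk' => ?_⟩
  · have := h0 v
    have := k0 (v - n)
    rw [prodF]
    split_ifs <;> omega
  · have := h1 v
    have := k1 (v - n)
    rw [prodF]
    split_ifs <;> omega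
  · rcases le_or_gt k r with h | h
    · obtain ⟨v, hv⟩ := h2 k hk h
      have := h0 v
      exact ⟨v, by rw [prodF]; split_ifs <;> omega⟩
    · obtain ⟨v, hv⟩ := k2 (k - r) (by omega) (by omega)
      have := k0 v
      refine ⟨n + v, ?_⟩
      rw [prodF, Nat.add_sub_cancel_left]
      split_ifs <;> omega

theorem prodF_le_iff {n r m s : ℕ} {γ δ : ℕ → ℕ} (hγ : IsPF n r γ) (hδ : IsPF m s δ)
    {v : ℕ} (_ : 1 ≤ v) (hvn : v ≤ n + m) : prodF n r γ δ v ≤ r ↔ v ≤ n := by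
  have := (isPF_iff.1 hγ).2.1 v
  have := hδ.1 (v - n)
  rw [prodF]
  split_ifs <;> omega

theorem IsPF.comp {N M r : ℕ} {f g : ℕ → ℕ} (hg : IsPF M r g) (hf : IsPF N M f) :
    IsPF N r (g ∘ f) := by
  obtain ⟨h0, h1, h2⟩ := isPF_iff.1 hf
  obtain ⟨k0, k1, k2⟩ := isPF_iff.1 hg
  refine isPF_iff.2 ⟨fun v => ?_, fun v => k1 _, fun k hk hk' => ?_⟩
  · have := k0 (f v)
    have := h1 v
    rw [← h0 v, Function.comp]
    omega
  · obtain ⟨w, hw⟩ := k2 k hk hk'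
    have := k0 w
    obtain ⟨v, rfl⟩ := h2 w (by omega) (by omega)
    exact ⟨v, hw⟩

/-- A shuffle preserves comparisons inside each of its two blocks. -/
theorem InSH.lt_iff_lt {r s : ℕ} {ω : ℕ → ℕ} (h : InSH [r, s] ω) {i j : ℕ} (hi : 1 ≤ i)
    (hi' : i ≤ r + s) (hj : 1 ≤ j) (hj' : j ≤ r + s) (hij : i ≤ r ↔ j ≤ r) :
    ω i < ω j ↔ i < j := by
  obtain ⟨_, h1, h2⟩ := inSH_pair_iff.1 h
  rcases lt_trichotomy i j with hlt | rfl | hlt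
  · have := h1 i j
    have := h2 i j
    omega
  · simp
  · have := h1 j i
    have := h2 j i
    omega

theorem InSH.sameSides_comp {n r m s : ℕ} {γ δ ω : ℕ → ℕ} (hγ : IsPF n r γ)
    (hδ : IsPF m s δ) (h : InSH [r, s] ω) :
    SameSides n m (ω ∘ prodF n r γ δ) (prodF n r γ δ) := by
  intro a b ha han hb hbn hab
  obtain ⟨h0, h1, -⟩ := isPF_iff.1 (isPF_prodF hγ hδ)
  have := (h0 a).2 ⟨ha, han⟩
  have := (h0 b).2 ⟨hb, hbn⟩
  exact h.lt_iff_lt (by omega) (h1 a) (by omega) (h1 b)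
    (by rw [prodF_le_iff hγ hδ ha han, prodF_le_iff hγ hδ hb hbn, hab])

theorem SameSides.trans_symm {n m : ℕ} {f g h : ℕ → ℕ} (hf : SameSides n m f h)
    (hg : SameSides n m g h) : SameSides n m f g :=
  fun a b h1 h2 h3 h4 h5 => (hf a b h1 h2 h3 h4 h5).trans (hg a b h1 h2 h3 h4 h5).symm

theorem ble_comp_prodF_iff {n r m s : ℕ} {γ δ ω ω' : ℕ → ℕ} (hγ : IsPF n r γ)
    (hδ : IsPF m s δ) (h : InSH [r, s] ω) (h' : InSH [r, s] ω') :
    BLE (n + m) (ω ∘ prodF n r γ δ) (ω' ∘ prodF n r γ δ) ↔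
      ∀ i j, 1 ≤ i → i ≤ r → r < j → j ≤ r + s → PairLE ω ω' i j := by
  have hP := isPF_prodF hγ hδ
  obtain ⟨h0, h1, h2⟩ := isPF_iff.1 hP
  constructor
  · intro hb i j hi hir hj hjs
    obtain ⟨a, rfl⟩ := h2 i hi (by omega)
    obtain ⟨b, rfl⟩ := h2 j (by omega) hjs
    have ha := (h0 a).1 (by omega)
    have hb' := (h0 b).1 (by omega)
    have e1 := prodF_le_iff hγ hδ ha.1 ha.2
    have e2 := prodF_le_iff hγ hδ hb'.1 hb'.2
    exact hb.pairLE (a := a) (b := b) (by omega)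
  · intro hle
    obtain ⟨⟨u, hu⟩, -⟩ := inSH_pair_iff.1 h
    obtain ⟨⟨u', hu'⟩, -⟩ := inSH_pair_iff.1 h'
    refine ble_of_pairLE (hu.comp hP) (hu'.comp hP)
      ((h.sameSides_comp hγ hδ).trans_symm (h'.sameSides_comp hγ hδ)) fun a b ha han hb hbn => ?_
    have e1 := prodF_le_iff hγ hδ ha (by omega)
    have e2 := prodF_le_iff hγ hδ (by omega) hbn
    have := (h0 a).2 (by omega)
    exact hle _ _ (by omega) (by omega) (by omega) (h1 b)

/-- A packed word comparing positions on each side of `n` as `γ × δ` does factors through a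
shuffle. -/
theorem exists_inSH_comp_eq {n r m s u : ℕ} {γ δ φ : ℕ → ℕ} (hγ : IsPF n r γ)
    (hδ : IsPF m s δ) (hφ : IsPF (n + m) u φ) (hs : SameSides n m φ (prodF n r γ δ)) :
    ∃ ω, InSH [r, s] ω ∧ ω ∘ prodF n r γ δ = φ := by
  classical
  have hP := isPF_prodF hγ hδ
  have hside := fun v => prodF_le_iff hγ hδ (v := v)
  generalize prodF n r γ δ = P at *
  obtain ⟨h0, h1, h2⟩ := isPF_iff.1 hP
  obtain ⟨k0, k1, k2⟩ := isPF_iff.1 hφ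
  have hsec : ∀ v, ∃ a, 1 ≤ v ∧ v ≤ r + s → P a = v := fun v => by
    by_cases hv : 1 ≤ v ∧ v ≤ r + s
    · exact (h2 v hv.1 hv.2).imp fun a ha _ => ha
    · exact ⟨0, fun h => absurd h hv⟩
  choose σ hσ using hsec
  refine ⟨fun v => if 1 ≤ v ∧ v ≤ r + s then φ (σ v) else 0, ?_⟩
  have hcomp : (fun v => if 1 ≤ v ∧ v ≤ r + s then φ (σ v) else 0) ∘ P = φ := by
    funext a
    have ha := h0 a
    have ha' := k0 a
    have ha'' := h1 a
    have hPa := hσ (P a)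
    simp only [Function.comp]
    split_ifs with hc
    · have hb := h0 (σ (P a))
      have e1 := hside a
      have e2 := hside (σ (P a))
      have e3 := hs a (σ (P a)) (by omega) (by omega) (by omega) (by omega) (by omega)
      have e4 := hs (σ (P a)) a (by omega) (by omega) (by omega) (by omega) (by omega)
      omega
    · omega
  refine ⟨inSH_pair_iff.2 ⟨⟨u, isPF_iff.2 ⟨fun v => ?_, fun v => ?_, fun k hk hk' => ?_⟩⟩,
    fun i j hi hij hj => ?_, fun i j hi hij hj => ?_⟩, hcomp⟩
  · have := hσ v
    have := h0 (σ v)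
    have := k0 (σ v)
    split_ifs <;> omega
  · have := k1 (σ v)
    split_ifs <;> omega
  · obtain ⟨a, ha⟩ := k2 k hk hk'
    exact ⟨P a, ha ▸ congrFun hcomp a⟩
  all_goals
    have e1 := hσ i
    have e2 := hσ j
    have e3 := h0 (σ i)
    have e4 := h0 (σ j)
    have e5 := hside (σ i)
    have e6 := hside (σ j)
    have e7 := hs (σ i) (σ j) (by omega) (by omega) (by omega) (by omega) (by omega)
    split_ifs <;> omega

theorem bijOn_interval {n r m s : ℕ} {γ δ ℓ μ : ℕ → ℕ} (hγ : IsPF n r γ) (hδ : IsPF m s δ)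
    (hℓ : InSH [r, s] ℓ) (hμ : InSH [r, s] μ) :
    Set.BijOn (· ∘ prodF n r γ δ)
      {ω | InSH [r, s] ω ∧ ∀ i j, 1 ≤ i → i ≤ r → r < j → j ≤ r + s →
        PairLE ℓ ω i j ∧ PairLE ω μ i j}
      {ω | (∃ u, IsPF (n + m) u ω) ∧ BLE (n + m) (ℓ ∘ prodF n r γ δ) ω ∧
        BLE (n + m) ω (μ ∘ prodF n r γ δ)} := by
  have hP := isPF_prodF hγ hδ
  refine ⟨?_, ?_, ?_⟩
  · rintro ω ⟨hω, hle⟩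
    obtain ⟨⟨u, hu⟩, -⟩ := inSH_pair_iff.1 hω
    exact ⟨⟨u, hu.comp hP⟩,
      (ble_comp_prodF_iff hγ hδ hℓ hω).2 fun i j h1 h2 h3 h4 => (hle i j h1 h2 h3 h4).1,
      (ble_comp_prodF_iff hγ hδ hω hμ).2 fun i j h1 h2 h3 h4 => (hle i j h1 h2 h3 h4).2⟩
  · rintro ω ⟨hω, -⟩ ω' ⟨hω', -⟩ heq
    obtain ⟨⟨u, hu⟩, -⟩ := inSH_pair_iff.1 hω
    obtain ⟨⟨u', hu'⟩, -⟩ := inSH_pair_iff.1 hω'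
    funext v
    by_cases hv : 1 ≤ v ∧ v ≤ r + s
    · obtain ⟨a, rfl⟩ := (isPF_iff.1 hP).2.2 v hv.1 hv.2
      exact congrFun heq a
    · have := hu.1 v
      have := hu'.1 v
      omega
  · rintro φ ⟨⟨u, hφ⟩, h1, h2⟩
    have hlow := hℓ.sameSides_comp hγ hδ
    have hupp := hμ.sameSides_comp hγ hδ
    have hs : SameSides n m φ (prodF n r γ δ) := by
      intro a b ha han hb hbn hab
      rw [← hlow a b ha han hb hbn hab]
      have e1 := (hlow a b ha han hb hbn hab).trans (hupp a b ha han hb hbn hab).symm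
      have e2 := (hlow b a hb hbn ha han hab.symm).trans (hupp b a hb hbn ha han hab.symm).symm
      rcases lt_trichotomy a b with hlt | rfl | hlt
      · have e3 := h1.pairLE hlt
        have e4 := h2.pairLE hlt
        simp only [PairLE] at e3 e4
        omega
      · omega
      · have e3 := h1.pairLE hlt
        have e4 := h2.pairLE hlt
        simp only [PairLE] at e3 e4
        omega
    obtain ⟨ω, hω, rfl⟩ := exists_inSH_comp_eq hγ hδ hφ hs
    exact ⟨ω, ⟨hω, fun i j hi hir hj hjs =>
      ⟨(ble_comp_prodF_iff hγ hδ hℓ hω).1 h1 i j hi hir hj hjs,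
        (ble_comp_prodF_iff hγ hδ hω hμ).1 h2 i j hi hir hj hjs⟩⟩, rfl⟩

theorem finsum_interval (k : Type*) [Field k] {n r m s : ℕ} {γ δ ℓ μ : ℕ → ℕ}
    (hγ : IsPF n r γ) (hδ : IsPF m s δ) (hℓ : InSH [r, s] ℓ) (hμ : InSH [r, s] μ)
    {c : (ℕ → ℕ) → Prop}
    (hc : ∀ ω, InSH [r, s] ω → (c ω ↔ ∀ i j, 1 ≤ i → i ≤ r → r < j → j ≤ r + s →
        PairLE ℓ ω i j ∧ PairLE ω μ i j)) :
    ∑ᶠ ω ∈ {ω : ℕ → ℕ | InSH [r, s] ω ∧ c ω},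
        Finsupp.single (n + m, ω ∘ prodF n r γ δ) (1 : k) =
      ∑ᶠ ω ∈ {ω : ℕ → ℕ | (∃ u : ℕ, IsPF (n + m) u ω) ∧
          BLE (n + m) (ℓ ∘ prodF n r γ δ) ω ∧ BLE (n + m) ω (μ ∘ prodF n r γ δ)},
        Finsupp.single (n + m, ω) (1 : k) := by
  refine finsum_mem_eq_of_bijOn (· ∘ prodF n r γ δ) ?_ fun _ _ => rfl
  convert bijOn_interval hγ hδ hℓ hμ using 1
  ext ω
  exact and_congr_right (hc ω)

theorem lift2_shOp_single (k : Type*) [Field k] (c : ℕ → ℕ → (ℕ → ℕ) → Prop)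
    {n r m s : ℕ} {γ δ : ℕ → ℕ} (hγ : IsPF n r γ) (hδ : IsPF m s δ) :
    lift2 (shOp k c) (Finsupp.single (n, γ) 1) (Finsupp.single (m, δ) 1) =
      ∑ᶠ ω ∈ {ω : ℕ → ℕ | InSH [r, s] ω ∧ c r s ω},
        Finsupp.single (n + m, ω ∘ prodF n r γ δ) (1 : k) := by
  rw [lift2, Finsupp.sum_single_index, Finsupp.sum_single_index]
  · simp [shOp, rankF_eq hγ, rankF_eq hδ]
  · simp
  · simp [Finsupp.sum]

theorem xiF_pair (a b v : ℕ) :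
    xiF [a, b] v = if v = 0 then 0 else if v ≤ a then v + b else if v ≤ a + b then v - a else 0 := by
  simp only [xiF, List.sum_cons, List.sum_nil]
  split_ifs <;> omega

theorem prodF_xiF_idF (a b v : ℕ) :
    prodF (a + b) (a + b) (xiF [a, b]) (idF 1) v =
      if v = 0 then 0 else if v ≤ a then v + b else if v ≤ a + b then v - a
        else if v = a + b + 1 then v else 0 := by
  simp only [prodF, idF, xiF_pair]
  split_ifs <;> omega

theorem ofList_insert {r : ℕ} (hr : 1 ≤ r) (x s v : ℕ) :
    ofList (List.range' 1 (r - 1) ++ x :: List.range' r s) v =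
      if v < r then v else if v = r then x else if v ≤ r + s then v - 1 else 0 := by
  rw [ofList]
  rcases lt_trichotomy v r with h | rfl | h
  · simp only [h, if_true]
    split_ifs with h0
    · omega
    · rw [List.getD_append _ _ _ _ (by simp; omega)]
      rw [List.getD_eq_getElem _ _ (by simp; omega), List.getElem_range']
      omega
  · rw [List.getD_append_right _ _ _ _ (by simp)]
    simp
    omega
  · obtain ⟨d, rfl⟩ := Nat.exists_eq_add_of_lt h
    rw [List.getD_append_right _ _ _ _ (by simp; omega),
      show r + d + 1 - 1 - (List.range' 1 (r - 1)).length = d + 1 by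
        rw [List.length_range']; omega,
      List.getD_cons_succ]
    by_cases hd : d < s
    · rw [List.getD_eq_getElem _ _ (by simpa using hd), List.getElem_range']
      split_ifs <;> first | omega | contradiction
    · rw [List.getD_eq_default _ _ (by simpa using hd)]
      split_ifs <;> omega

theorem prodF_comp_ofList_insert (r s v : ℕ) :
    (prodF (r + s) (r + s) (xiF [r, s]) (idF 1) ∘
      ofList (List.range' 1 (r + 1 - 1) ++ (r + s + 1) :: List.range' (r + 1) (s + 1))) v =
      if v = 0 then 0 else if v ≤ r then v + s else if v = r + 1 then r + s + 1
        else if v ≤ r + s + 1 then v - (r + 1) else if v = r + s + 2 then r + s + 1 else 0 := by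
  rw [Function.comp, ofList_insert (Nat.succ_pos r), prodF_xiF_idF]
  rcases lt_trichotomy v (r + 1) with h | rfl | h
  · simp only [h, if_true]
    split_ifs <;> omega
  · simp
  · simp only [h.not_gt, h.ne', if_false]
    by_cases h' : v ≤ r + 1 + (s + 1)
    · simp only [h', if_true]
      split_ifs <;> omega
    · simp only [h', if_false]
      split_ifs <;> omega

theorem inSH_idF (r s : ℕ) : InSH [r, s] (idF (r + s)) := by
  refine inSH_pair_iff.2 ⟨⟨r + s, isPF_iff.2 ⟨fun v => ?_, fun v => ?_, fun k hk hk' => ⟨k, ?_⟩⟩⟩,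
    fun a b h1 h2 h3 => ?_, fun a b h1 h2 h3 => ?_⟩ <;>
  · simp only [idF]
    split_ifs <;> omega

theorem inSH_xiF (r s : ℕ) : InSH [r, s] (xiF [r, s]) := by
  refine inSH_pair_iff.2 ⟨⟨r + s, isPF_iff.2 ⟨fun v => ?_, fun v => ?_,
    fun k hk hk' => ⟨if k ≤ s then k + r else k - s, ?_⟩⟩⟩,
    fun a b h1 h2 h3 => ?_, fun a b h1 h2 h3 => ?_⟩ <;>
  · simp only [xiF_pair]
    split_ifs <;> omega

theorem inSH_prodF_xiF_idF (r s : ℕ) :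
    InSH [r, s + 1] (prodF (r + s) (r + s) (xiF [r, s]) (idF 1)) := by
  refine inSH_pair_iff.2 ⟨⟨r + s + 1, isPF_iff.2 ⟨fun v => ?_, fun v => ?_,
    fun k hk hk' => ⟨if k ≤ s then k + r else if k ≤ r + s then k - s else k, ?_⟩⟩⟩,
    fun a b h1 h2 h3 => ?_, fun a b h1 h2 h3 => ?_⟩ <;>
  · simp only [prodF_xiF_idF]
    split_ifs <;> omega

theorem inSH_ofList_insert_merged (r s : ℕ) :
    InSH [r + 1, s + 1]
      (ofList (List.range' 1 (r + 1 - 1) ++ (r + s + 1) :: List.range' (r + 1) (s + 1))) := by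
  refine inSH_pair_iff.2 ⟨⟨r + s + 1, isPF_iff.2 ⟨fun v => ?_, fun v => ?_,
    fun k hk hk' => ⟨if k ≤ r then k else k + 1, ?_⟩⟩⟩,
    fun a b h1 h2 h3 => ?_, fun a b h1 h2 h3 => ?_⟩ <;>
  · simp only [ofList_insert (Nat.succ_pos r)]
    split_ifs <;> omega

theorem inSH_prodF_comp_ofList_insert (r s : ℕ) :
    InSH [r + 1, s + 1] (prodF (r + s) (r + s) (xiF [r, s]) (idF 1) ∘
      ofList (List.range' 1 (r + 1 - 1) ++ (r + s + 1) :: List.range' (r + 1) (s + 1))) := by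
  refine inSH_pair_iff.2 ⟨⟨r + s + 1, isPF_iff.2 ⟨fun v => ?_, fun v => ?_,
    fun k hk hk' => ⟨if k ≤ s then k + r + 1 else if k ≤ r + s then k - s else r + 1, ?_⟩⟩⟩,
    fun a b h1 h2 h3 => ?_, fun a b h1 h2 h3 => ?_⟩ <;>
  · simp only [prodF_comp_ofList_insert]
    split_ifs <;> first | omega | contradiction

theorem inSH_ofList_insert_top (r s : ℕ) :
    InSH [r + 1, s] (ofList (List.range' 1 (r + 1 - 1) ++ (r + 1 + s) ::
      List.range' (r + 1) s)) := by
  refine inSH_pair_iff.2 ⟨⟨r + 1 + s, isPF_iff.2 ⟨fun v => ?_, fun v => ?_,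
    fun k hk hk' => ⟨if k ≤ r then k else if k ≤ r + s then k + 1 else r + 1, ?_⟩⟩⟩,
    fun a b h1 h2 h3 => ?_, fun a b h1 h2 h3 => ?_⟩ <;>
  · simp only [ofList_insert (Nat.succ_pos r)]
    split_ifs <;> omega

theorem idF_comp {N M : ℕ} {f : ℕ → ℕ} (hf : IsPF N M f) : idF M ∘ f = f := by
  funext v
  have := (isPF_iff.1 hf).2.1 v
  simp only [Function.comp, idF]
  split_ifs <;> omega

theorem InSH.lt_blockEnd {r s : ℕ} {ω : ℕ → ℕ} (h : InSH [r, s] ω) {i j : ℕ} (hi : 1 ≤ i)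
    (hj : r < j) :
    (i < r → ω i < ω r) ∧ (j < r + s → ω j < ω (r + s)) := by
  obtain ⟨-, h1, h2⟩ := inSH_pair_iff.1 h
  exact ⟨fun h => h1 i r hi h le_rfl, fun h => h2 j (r + s) hj h le_rfl⟩

theorem succ_cond_iff {r s : ℕ} {ω : ℕ → ℕ} (h : InSH [r + 1, s + 1] ω) :
    ω (r + 1) < ω (r + 1 + (s + 1)) ↔ ∀ i j, 1 ≤ i → i ≤ r + 1 → r + 1 < j →
      j ≤ r + 1 + (s + 1) → PairLE (idF (r + 1 + (s + 1))) ω i j ∧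
        PairLE ω (prodF (r + 1 + s) (r + 1 + s) (xiF [r + 1, s]) (idF 1)) i j := by
  constructor
  · intro hlt i j hi hir hj hjs
    obtain ⟨e1, e2⟩ := h.lt_blockEnd hi hj
    simp only [PairLE, idF, prodF_xiF_idF]
    rcases Nat.eq_or_lt_of_le hir with rfl | hir <;> rcases Nat.eq_or_lt_of_le hjs with rfl | hjs <;>
      split_ifs <;> first | omega | contradiction
  · intro hle
    have := hle (r + 1) (r + 1 + (s + 1)) (by omega) (by omega) (by omega) (by omega)
    simp only [PairLE, idF, prodF_xiF_idF] at this
    split_ifs at this <;> first | omega | contradiction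

theorem dot_cond_iff {r s : ℕ} {ω : ℕ → ℕ} (h : InSH [r + 1, s + 1] ω) :
    ω (r + 1) = ω (r + 1 + (s + 1)) ↔ ∀ i j, 1 ≤ i → i ≤ r + 1 → r + 1 < j →
      j ≤ r + 1 + (s + 1) →
        PairLE (ofList (List.range' 1 (r + 1 - 1) ++ (r + s + 1) ::
          List.range' (r + 1) (s + 1))) ω i j ∧
        PairLE ω (prodF (r + s) (r + s) (xiF [r, s]) (idF 1) ∘
          ofList (List.range' 1 (r + 1 - 1) ++ (r + s + 1) ::
            List.range' (r + 1) (s + 1))) i j := by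
  constructor
  · intro hlt i j hi hir hj hjs
    obtain ⟨e1, e2⟩ := h.lt_blockEnd hi hj
    have hℓ := ofList_insert (Nat.succ_pos r) (r + s + 1) (s + 1)
    have hμ := prodF_comp_ofList_insert r s
    generalize prodF (r + s) (r + s) (xiF [r, s]) (idF 1) ∘ ofList _ = μ at hμ ⊢
    generalize ofList _ = ℓ at hℓ ⊢
    have hℓi : (i < r + 1 → ℓ i = i) ∧ (i = r + 1 → ℓ i = r + s + 1) := by
      rw [hℓ]; split_ifs <;> omega
    have hℓj : ℓ j = j - 1 := by
      rw [hℓ]; split_ifs <;> omega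
    have hμi : (i < r + 1 → μ i = i + s) ∧ (i = r + 1 → μ i = r + s + 1) := by
      rw [hμ]; split_ifs <;> omega
    have hμj : (j < r + 1 + (s + 1) → μ j = j - (r + 1)) ∧
        (j = r + 1 + (s + 1) → μ j = r + s + 1) := by
      rw [hμ]; split_ifs <;> omega
    simp only [PairLE]
    rcases Nat.eq_or_lt_of_le hir with rfl | hir <;> rcases Nat.eq_or_lt_of_le hjs with rfl | hjs <;>
      omega
  · intro hle
    have := hle (r + 1) (r + 1 + (s + 1)) (by omega) (by omega) (by omega) (by omega)
    simp only [PairLE, prodF_comp_ofList_insert, ofList_insert (Nat.succ_pos r)] at this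
    split_ifs at this <;> omega

theorem prec_cond_iff {r s : ℕ} {ω : ℕ → ℕ} (h : InSH [r + 1, s + 1] ω) :
    ω (r + 1 + (s + 1)) < ω (r + 1) ↔ ∀ i j, 1 ≤ i → i ≤ r + 1 → r + 1 < j →
      j ≤ r + 1 + (s + 1) →
        PairLE (ofList (List.range' 1 (r + 1 - 1) ++ (r + 1 + (s + 1)) ::
          List.range' (r + 1) (s + 1))) ω i j ∧
        PairLE ω (xiF [r + 1, s + 1]) i j := by
  constructor
  · intro hlt i j hi hir hj hjs
    obtain ⟨e1, e2⟩ := h.lt_blockEnd hi hj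
    simp only [PairLE, ofList_insert (Nat.succ_pos r), xiF_pair]
    rcases Nat.eq_or_lt_of_le hir with rfl | hir <;> rcases Nat.eq_or_lt_of_le hjs with rfl | hjs <;>
      split_ifs <;> first | omega | contradiction
  · intro hle
    have := hle (r + 1) (r + 1 + (s + 1)) (by omega) (by omega) (by omega) (by omega)
    simp only [PairLE, ofList_insert (Nat.succ_pos r), xiF_pair] at this
    split_ifs at this <;> omega

theorem pairLE_idF_xiF {r s i j : ℕ} (ω : ℕ → ℕ) (hi : 1 ≤ i) (hir : i ≤ r) (hj : r < j)
    (hjs : j ≤ r + s) : PairLE (idF (r + s)) ω i j ∧ PairLE ω (xiF [r, s]) i j := by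
  simp only [PairLE, idF, xiF_pair]
  split_ifs <;> omega

theorem starP_single (k : Type*) [Field k] {n r m s : ℕ} {γ δ : ℕ → ℕ} (hγ : IsPF n r γ)
    (hδ : IsPF m s δ) :
    starP k (Finsupp.single (n, γ) 1) (Finsupp.single (m, δ) 1) =
      ∑ᶠ ω ∈ {ω : ℕ → ℕ | InSH [r, s] ω ∧ True},
        Finsupp.single (n + m, ω ∘ prodF n r γ δ) (1 : k) := by
  have hfin : ∀ c : (ℕ → ℕ) → Prop, {ω : ℕ → ℕ | InSH [r, s] ω ∧ c ω}.Finite := fun c =>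
    (finite_setOf_isPF (r + s)).subset fun ω hω => (inSH_pair_iff.1 hω.1).1
  rw [starP, succP, dotP, precP, lift2_shOp_single k _ hγ hδ, lift2_shOp_single k _ hγ hδ,
    lift2_shOp_single k _ hγ hδ, ← finsum_mem_union _ (hfin _) (hfin _),
    ← finsum_mem_union _ ((hfin _).union (hfin _)) (hfin _)]
  · refine finsum_mem_congr (Set.ext fun ω => ?_) fun _ _ => rfl
    change ((_ ∧ ω r < ω (r + s)) ∨ (_ ∧ ω r = ω (r + s))) ∨ (_ ∧ ω (r + s) < ω r) ↔ _ ∧ True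
    rw [← and_or_left, ← and_or_left]
    exact and_congr_right fun _ => iff_of_true (by omega) trivial
  · refine Set.disjoint_left.2 ?_
    rintro ω (⟨_, h : ω r < ω (r + s)⟩ | ⟨_, h : ω r = ω (r + s)⟩)
      ⟨_, h' : ω (r + s) < ω r⟩ <;> omega
  · refine Set.disjoint_left.2 ?_
    rintro ω ⟨_, h : ω r < ω (r + s)⟩ ⟨_, h' : ω r = ω (r + s)⟩
    omega

/-- for `γ ∈ P_{n,r}` and `δ ∈ P_{m,s}`, the dendriform trialgebra operations
of `k[P_∞]` are sums over weak Bruhat intervals: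
`γ ≻ δ = Σ_{γ×δ ≤_B ω ≤_B (ξ_{r,s-1}×1₁)∘(γ×δ)} ω`,
`γ · δ = Σ_{z(r-1,s-1,0)∘(γ×δ) ≤_B ω ≤_B (ξ_{r-1,s-1}×1₁)∘z(r-1,s-1,0)∘(γ×δ)} ω`,
`γ ≺ δ = Σ_{z(r-1,s)∘(γ×δ) ≤_B ω ≤_B ξ_{r,s}∘(γ×δ)} ω`,
`γ * δ = Σ_{γ×δ ≤_B ω ≤_B ξ_{r,s}∘(γ×δ)} ω`. -/
theorem operations_eq_weak_intervals (k : Type*) [Field k]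
    (n r m s : ℕ) (γ δ : ℕ → ℕ) (hn : 1 ≤ n) (hm : 1 ≤ m)
    (hγ : IsPF n r γ) (hδ : IsPF m s δ) :
    (succP k (Finsupp.single (n, γ) 1) (Finsupp.single (m, δ) 1) =
      ∑ᶠ ω ∈ {ω : ℕ → ℕ | (∃ u : ℕ, IsPF (n + m) u ω) ∧
          BLE (n + m) (prodF n r γ δ) ω ∧
          BLE (n + m) ω (prodF (r + s - 1) (r + s - 1) (xiF [r, s - 1]) (idF 1) ∘
            prodF n r γ δ)},
        Finsupp.single (n + m, ω) (1 : k)) ∧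
    (dotP k (Finsupp.single (n, γ) 1) (Finsupp.single (m, δ) 1) =
      ∑ᶠ ω ∈ {ω : ℕ → ℕ | (∃ u : ℕ, IsPF (n + m) u ω) ∧
          BLE (n + m) (ofList (List.range' 1 (r - 1) ++ (r + s - 1) :: List.range' r s) ∘
            prodF n r γ δ) ω ∧
          BLE (n + m) ω (prodF (r + s - 2) (r + s - 2) (xiF [r - 1, s - 1]) (idF 1) ∘
            ofList (List.range' 1 (r - 1) ++ (r + s - 1) :: List.range' r s) ∘
            prodF n r γ δ)},
        Finsupp.single (n + m, ω) (1 : k)) ∧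
    (precP k (Finsupp.single (n, γ) 1) (Finsupp.single (m, δ) 1) =
      ∑ᶠ ω ∈ {ω : ℕ → ℕ | (∃ u : ℕ, IsPF (n + m) u ω) ∧
          BLE (n + m) (ofList (List.range' 1 (r - 1) ++ (r + s) :: List.range' r s) ∘
            prodF n r γ δ) ω ∧
          BLE (n + m) ω (xiF [r, s] ∘ prodF n r γ δ)},
        Finsupp.single (n + m, ω) (1 : k)) ∧
    (starP k (Finsupp.single (n, γ) 1) (Finsupp.single (m, δ) 1) =
      ∑ᶠ ω ∈ {ω : ℕ → ℕ | (∃ u : ℕ, IsPF (n + m) u ω) ∧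
          BLE (n + m) (prodF n r γ δ) ω ∧
          BLE (n + m) ω (xiF [r, s] ∘ prodF n r γ δ)},
        Finsupp.single (n + m, ω) (1 : k)) := by
  obtain ⟨r, rfl⟩ : ∃ q, r = q + 1 := Nat.exists_eq_add_one.2 <| by
    have := (isPF_iff.1 hγ).2.1 n
    have := hγ.1 n
    omega
  obtain ⟨s, rfl⟩ : ∃ q, s = q + 1 := Nat.exists_eq_add_one.2 <| by
    have := (isPF_iff.1 hδ).2.1 m
    have := hδ.1 m
    omega
  have hid := idF_comp (isPF_prodF hγ hδ)
  refine ⟨?_, ?_, ?_, ?_⟩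
  · have h := finsum_interval k hγ hδ (inSH_idF _ _) (inSH_prodF_xiF_idF (r + 1) s)
      fun _ => succ_cond_iff
    rw [hid] at h
    exact (lift2_shOp_single k _ hγ hδ).trans h
  · have h := finsum_interval k hγ hδ (inSH_ofList_insert_merged r s)
      (inSH_prodF_comp_ofList_insert r s) fun _ => dot_cond_iff
    rw [show r + 1 + (s + 1) - 1 = r + s + 1 by omega, show r + 1 + (s + 1) - 2 = r + s by omega]
    exact (lift2_shOp_single k _ hγ hδ).trans h
  · exact (lift2_shOp_single k _ hγ hδ).trans <| finsum_interval k hγ hδ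
      (inSH_ofList_insert_top r (s + 1)) (inSH_xiF _ _) fun _ => prec_cond_iff
  · have h := finsum_interval k hγ hδ (inSH_idF _ _) (inSH_xiF _ _) (c := fun _ => True)
      fun ω _ => ⟨fun _ _ _ => pairLE_idF_xiF ω, fun _ => trivial⟩
    rw [hid] at h
    exact (starP_single k hγ hδ).trans h

end PaperP
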